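/- Let F be a field and let D be a local subring of F whose prime spectrum Spec D is a Noetherian topological space. Let X be a projective model of F/D and let Y be a nonempty Zariski closed subset of the set of local rings in X that dominate D. Then A(Y) is a semilocal ring (it has only finitely many maximal ideals), and every maximal ideal of A(Y) is of the form m_α ∩ A(Y) for some local ring α in Y. -/

import Mathlib

/-!
Common definitions: valuation rings of a field, the Zariski--Riemann space
`Zar_F(D)` with its Zariski and patch topologies, domination of local subrings,
residual algebraicity, integral closedness, and projective models of `F/D`.
-/

variable {F : Type*} [Field F]

/-- `x` lies in the maximal ideal (set of nonunits) of the (local) subring `R` of `F`. -/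
def MemMaxIdeal (R : Subring F) (x : F) : Prop :=
  ∃ h : x ∈ R, ¬ IsUnit (⟨x, h⟩ : R)

/-- The local ring `R` dominates the local ring `S` (both subrings of `F`):
`S ⊆ R` and the maximal ideal of `R` contracts to the maximal ideal of `S`. -/
def Dominates (R S : Subring F) : Prop :=
  S ≤ R ∧ ∀ x ∈ S, (MemMaxIdeal S x ↔ MemMaxIdeal R x)

/-- `V` is a valuation ring of the field `F`: for every nonzero `x ∈ F`,
`x ∈ V` or `x⁻¹ ∈ V`. -/
def IsValSubring (V : Subring F) : Prop :=
  ∀ x : F, x ≠ 0 → x ∈ V ∨ x⁻¹ ∈ V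

/-- `Zar_F(D)`: the valuation rings of `F` containing `D`. -/
def zarSet (D : Subring F) : Set (Subring F) :=
  {V | IsValSubring V ∧ D ≤ V}

/-- `Dom_F(D)`: the valuation rings of `F` dominating the local subring `D`. -/
def domSet (D : Subring F) : Set (Subring F) :=
  {V | IsValSubring V ∧ Dominates V D}

/-- The Zariski topology on a collection `X` of subrings of `F`, with basic open sets
`U(x₁,…,xₙ) = {R ∈ X : x₁,…,xₙ ∈ R}`. -/
def zariskiTop (X : Set (Subring F)) : TopologicalSpace X :=
  TopologicalSpace.generateFrom
    {U | ∃ s : Finset F, U = {R : X | ∀ x ∈ s, x ∈ (R : Subring F)}}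

/-- The patch topology on a collection `X` of subrings of `F`: generated by the
quasicompact Zariski-open sets together with their complements. -/
def patchTop (X : Set (Subring F)) : TopologicalSpace X :=
  TopologicalSpace.generateFrom
    ({U | @IsOpen _ (zariskiTop X) U ∧ @IsCompact _ (zariskiTop X) U} ∪
      {V | ∃ U, @IsOpen _ (zariskiTop X) U ∧ @IsCompact _ (zariskiTop X) U ∧ V = Uᶜ})

/-- `R` is residually algebraic over `D`: the residue field extension
`D/m_D → R/m_R` is algebraic, i.e. each element of `R` satisfies, modulo the
maximal ideal of `R`, a monic polynomial with coefficients in `D`. -/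
def ResiduallyAlgebraic (D R : Subring F) : Prop :=
  ∀ x ∈ R, ∃ p : Polynomial F, p.Monic ∧ (∀ i, p.coeff i ∈ D) ∧ MemMaxIdeal R (p.eval x)

/-- `R` is integrally closed in `F`: every element of `F` integral over `R` lies in `R`. -/
def IntegrallyClosedIn (R : Subring F) : Prop :=
  ∀ x : F, (∃ p : Polynomial F, p.Monic ∧ (∀ i, p.coeff i ∈ R) ∧ p.eval x = 0) → x ∈ R

/-- The localization of the subring `A` of `F` at the prime ideal `P`, viewed as the
subring of `F` generated by the fractions `a/b` with `a, b ∈ A`, `b ∉ P`. -/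
def localizationSubring (A : Subring F) (P : Ideal A) : Subring F :=
  Subring.closure {z : F | ∃ a b : A, b ∉ P ∧ z = (a : F) * (b : F)⁻¹}

/-- The ring `D[x₁/xᵢ, …, xₙ/xᵢ]`. -/
def modelChart (D : Subring F) {n : ℕ} (x : Fin n → F) (i : Fin n) : Subring F :=
  Subring.closure ((D : Set F) ∪ {y | ∃ j, y = x j * (x i)⁻¹})

/-- `X` is the projective model of `F/D` defined by some nonzero elements
`x₀, …, xₙ` of `F`: the set of all localizations of the rings
`D[x₀/xᵢ, …, xₙ/xᵢ]` at their prime ideals. -/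
def IsProjModel (D : Subring F) (X : Set (Subring F)) : Prop :=
  ∃ (n : ℕ) (x : Fin (n + 1) → F), (∀ i, x i ≠ 0) ∧
    X = {R | ∃ (i : Fin (n + 1)) (P : Ideal (modelChart D x i)),
          P.IsPrime ∧ R = localizationSubring (modelChart D x i) P}

/-- `X(Z)`: the members of the projective model `X` dominated by some valuation ring
in `Z`. -/
def modelImage (X Z : Set (Subring F)) : Set (Subring F) :=
  {α ∈ X | ∃ V ∈ Z, Dominates V α}

/-- `A(Y)`: the intersection of a collection `Y` of subrings of `F`, as a subset of `F`. -/
def ringsInter (Y : Set (Subring F)) : Set F :=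
  ⋂ R ∈ Y, (R : Set F)

/-! ### Nonunits of subrings of a field -/

theorem memMaxIdeal_iff {R : Subring F} {x : F} :
    MemMaxIdeal R x ↔ x ∈ R ∧ ¬ (x ≠ 0 ∧ x⁻¹ ∈ R) := by
  constructor
  · rintro ⟨h, hu⟩
    refine ⟨h, fun ⟨h0, hi⟩ => hu ?_⟩
    exact IsUnit.of_mul_eq_one ⟨x⁻¹, hi⟩ (Subtype.ext (mul_inv_cancel₀ h0))
  · rintro ⟨h, hu⟩
    refine ⟨h, fun hx => hu ?_⟩
    obtain ⟨y, hy⟩ := isUnit_iff_exists_inv.mp hx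
    have hxy : x * (y : F) = 1 := congrArg Subtype.val hy
    exact ⟨left_ne_zero_of_mul_eq_one hxy, by
      rw [inv_eq_of_mul_eq_one_right hxy]; exact y.2⟩

theorem memMaxIdeal_coe {R : Subring F} [IsLocalRing R] (x : R) :
    MemMaxIdeal R (x : F) ↔ x ∈ IsLocalRing.maximalIdeal R :=
  ⟨fun ⟨_, h⟩ => h, fun h => ⟨x.2, h⟩⟩

theorem MemMaxIdeal.mono {R S : Subring F} (h : R ≤ S) {x : F} (hx : x ∈ R)
    (hS : MemMaxIdeal S x) : MemMaxIdeal R x := by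
  rw [memMaxIdeal_iff] at hS ⊢
  exact ⟨hx, fun hu => hS.2 ⟨hu.1, h hu.2⟩⟩

theorem MemMaxIdeal.sub {R : Subring F} [IsLocalRing R] {x y : F}
    (hx : MemMaxIdeal R x) (hy : MemMaxIdeal R y) : MemMaxIdeal R (x - y) :=
  (memMaxIdeal_coe (⟨x, hx.1⟩ - ⟨y, hy.1⟩ : R)).2 (sub_mem hx.2 hy.2)

theorem MemMaxIdeal.mul {R : Subring F} [IsLocalRing R] {x y : F}
    (hx : x ∈ R) (hy : MemMaxIdeal R y) : MemMaxIdeal R (x * y) :=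
  (memMaxIdeal_coe (⟨x, hx⟩ * ⟨y, hy.1⟩ : R)).2 (Ideal.mul_mem_left _ _ hy.2)

theorem not_memMaxIdeal_one (R : Subring F) : ¬ MemMaxIdeal R 1 := by
  rintro ⟨_, h⟩
  exact h isUnit_one

/-! ### Localizations inside the field -/

theorem mem_localizationSubring {A : Subring F} {P : Ideal A} (hP : P.IsPrime) {z : F} :
    z ∈ localizationSubring A P ↔ ∃ a b : A, b ∉ P ∧ z = (a : F) * (b : F)⁻¹ := by
  have ne : ∀ b : A, b ∉ P → (b : F) ≠ 0 := fun b hb h =>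
    hb ((Subtype.ext h : b = 0) ▸ P.zero_mem)
  have h1 : (1 : A) ∉ P := fun h => hP.ne_top (P.eq_top_iff_one.2 h)
  refine ⟨fun hz => ?_, fun hz => Subring.subset_closure hz⟩
  induction hz using Subring.closure_induction with
  | mem x hx => exact hx
  | zero => exact ⟨0, 1, h1, by simp⟩
  | one => exact ⟨1, 1, h1, by simp⟩
  | add x y _ _ hx hy =>
    obtain ⟨a, b, hb, rfl⟩ := hx
    obtain ⟨c, d, hd, rfl⟩ := hy
    refine ⟨a * d + c * b, b * d, fun h => (hP.mem_or_mem h).elim hb hd, ?_⟩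
    have := ne b hb
    have := ne d hd
    push_cast
    field_simp
  | neg x _ hx =>
    obtain ⟨a, b, hb, rfl⟩ := hx
    exact ⟨-a, b, hb, by simp⟩
  | mul x y _ _ hx hy =>
    obtain ⟨a, b, hb, rfl⟩ := hx
    obtain ⟨c, d, hd, rfl⟩ := hy
    refine ⟨a * c, b * d, fun h => (hP.mem_or_mem h).elim hb hd, ?_⟩
    have := ne b hb
    have := ne d hd
    push_cast
    field_simp

theorem le_localizationSubring {A : Subring F} {P : Ideal A} (hP : P.IsPrime) :
    A ≤ localizationSubring A P := fun a ha =>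
  (mem_localizationSubring hP).2 ⟨⟨a, ha⟩, 1, fun h => hP.ne_top (P.eq_top_iff_one.2 h), by simp⟩

theorem localizationSubring_le {A R : Subring F} {P : Ideal A} (hAR : A ≤ R)
    (h : ∀ b : A, b ∉ P → (b : F)⁻¹ ∈ R) : localizationSubring A P ≤ R := by
  refine Subring.closure_le.2 ?_
  rintro _ ⟨a, b, hb, rfl⟩
  exact mul_mem (hAR a.2) (h b hb)

theorem localizationSubring_anti {A : Subring F} {P Q : Ideal A} (hQ : Q.IsPrime) (h : Q ≤ P) :
    localizationSubring A P ≤ localizationSubring A Q :=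
  localizationSubring_le (le_localizationSubring hQ) fun b hb =>
    (mem_localizationSubring hQ).2 ⟨1, b, fun hbQ => hb (h hbQ), by simp⟩

theorem memMaxIdeal_localizationSubring {A : Subring F} {P : Ideal A} (hP : P.IsPrime) {a b : A}
    (hb : b ∉ P) : MemMaxIdeal (localizationSubring A P) ((a : F) * (b : F)⁻¹) ↔ a ∈ P := by
  have ne : ∀ b : A, b ∉ P → (b : F) ≠ 0 := fun b hb h =>
    hb ((Subtype.ext h : b = 0) ▸ P.zero_mem)
  have hb0 := ne b hb
  rw [memMaxIdeal_iff]
  constructor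
  · rintro ⟨-, h⟩
    by_contra ha
    refine h ⟨mul_ne_zero (ne a ha) (inv_ne_zero hb0), ?_⟩
    exact (mem_localizationSubring hP).2 ⟨b, a, ha, by rw [mul_inv, inv_inv, mul_comm]⟩
  · intro ha
    refine ⟨(mem_localizationSubring hP).2 ⟨a, b, hb, rfl⟩, ?_⟩
    rintro ⟨h0, hi⟩
    obtain ⟨c, d, hd, e⟩ := (mem_localizationSubring hP).1 hi
    have hd0 := ne d hd
    have ha0 : (a : F) ≠ 0 := left_ne_zero_of_mul h0
    have key : b * d = a * c := by
      refine Subtype.ext ?_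
      push_cast
      field_simp at e
      linear_combination e
    have : b * d ∈ P := key ▸ P.mul_mem_right _ ha
    exact (hP.mem_or_mem this).elim hb hd

theorem memMaxIdeal_localizationSubring_coe {A : Subring F} {P : Ideal A} (hP : P.IsPrime)
    (a : A) : MemMaxIdeal (localizationSubring A P) (a : F) ↔ a ∈ P := by
  have h1 : (1 : A) ∉ P := fun h => hP.ne_top (P.eq_top_iff_one.2 h)
  simpa using memMaxIdeal_localizationSubring hP (a := a) h1

theorem isLocalRing_localizationSubring {A : Subring F} {P : Ideal A} (hP : P.IsPrime) :
    IsLocalRing (localizationSubring A P) := by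
  refine IsLocalRing.of_nonunits_add ?_
  rintro ⟨x, hx⟩ ⟨y, hy⟩ hxu hyu
  have hxm : MemMaxIdeal _ x := ⟨hx, hxu⟩
  have hym : MemMaxIdeal _ y := ⟨hy, hyu⟩
  obtain ⟨a, b, hb, rfl⟩ := (mem_localizationSubring hP).1 hx
  obtain ⟨c, d, hd, rfl⟩ := (mem_localizationSubring hP).1 hy
  rw [memMaxIdeal_localizationSubring hP hb] at hxm
  rw [memMaxIdeal_localizationSubring hP hd] at hym
  have hbd : b * d ∉ P := fun h => (hP.mem_or_mem h).elim hb hd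
  have ne : ∀ b : A, b ∉ P → (b : F) ≠ 0 := fun b hb h =>
    hb ((Subtype.ext h : b = 0) ▸ P.zero_mem)
  have := ne b hb
  have := ne d hd
  have hmem : a * d + c * b ∈ P := P.add_mem (P.mul_mem_right _ hxm) (P.mul_mem_right _ hym)
  have e : ((a * d + c * b : A) : F) * ((b * d : A) : F)⁻¹ =
      (a : F) * (b : F)⁻¹ + (c : F) * (d : F)⁻¹ := by
    push_cast
    field_simp
  exact (e ▸ (memMaxIdeal_localizationSubring hP hbd).2 hmem : MemMaxIdeal _ _).2

theorem dominates_localizationSubring_iff {A D : Subring F} [IsLocalRing D] (hDA : D ≤ A)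
    {P : Ideal A} (hP : P.IsPrime) :
    Dominates (localizationSubring A P) D ↔
      (IsLocalRing.maximalIdeal D).map (Subring.inclusion hDA) ≤ P := by
  rw [Ideal.map_le_iff_le_comap]
  have key : ∀ d : D, MemMaxIdeal (localizationSubring A P) (d : F) ↔
      Subring.inclusion hDA d ∈ P := fun d =>
    memMaxIdeal_localizationSubring_coe hP (Subring.inclusion hDA d)
  constructor
  · intro h d hd
    exact (key d).1 ((h.2 d d.2).1 ((memMaxIdeal_coe d).2 hd))
  · refine fun h => ⟨hDA.trans (le_localizationSubring hP), fun x hx => ?_⟩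
    refine ((memMaxIdeal_coe (⟨x, hx⟩ : D)).trans ?_).trans (key ⟨x, hx⟩).symm
    refine ⟨fun hd => h hd, fun hd => ?_⟩
    by_contra hu
    exact hP.ne_top (P.eq_top_of_isUnit_mem hd
      ((not_not.1 hu : IsUnit (⟨x, hx⟩ : D)).map (Subring.inclusion hDA)))

/-! ### The Zariski topology on a set of subrings -/

theorem mem_of_isClosed_of_le {X : Set (Subring F)} {C : Set X}
    (hC : @IsClosed _ (zariskiTop X) C) {α β : X} (hα : α ∈ C) (h : (β : Subring F) ≤ α) :
    β ∈ C := by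
  have key : ∀ U : Set X, @IsOpen _ (zariskiTop X) U → β ∈ U → α ∈ U := by
    intro U hU
    change TopologicalSpace.GenerateOpen _ U at hU
    induction hU with
    | basic s hs =>
      obtain ⟨t, rfl⟩ := hs
      exact fun hβ x hx => h (hβ x hx)
    | univ => exact fun _ => trivial
    | inter s t _ _ hs ht => exact fun hβ => ⟨hs hβ.1, ht hβ.2⟩
    | sUnion S _ ih =>
      rintro ⟨s, hs, hβ⟩
      exact ⟨s, hs, ih s hs hβ⟩
  by_contra hβ
  exact key Cᶜ (@IsClosed.isOpen_compl _ (zariskiTop X) _ hC) hβ hα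

theorem continuous_localizationSubring {X : Set (Subring F)} (A : Subring F)
    (hX : ∀ P : PrimeSpectrum A, localizationSubring A P.asIdeal ∈ X) :
    @Continuous _ _ _ (zariskiTop X)
      (fun P : PrimeSpectrum A => (⟨localizationSubring A P.asIdeal, hX P⟩ : X)) := by
  refine continuous_generateFrom_iff.2 ?_
  rintro _ ⟨s, rfl⟩
  have : (fun P : PrimeSpectrum A => (⟨localizationSubring A P.asIdeal, hX P⟩ : X)) ⁻¹'
      {R : X | ∀ x ∈ s, x ∈ (R : Subring F)} =
      ⋂ x ∈ s, {P : PrimeSpectrum A | x ∈ localizationSubring A P.asIdeal} := by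
    ext P
    simp
  rw [this]
  refine isOpen_biInter_finset fun x _ => isOpen_iff_forall_mem_open.2 fun P hPx => ?_
  obtain ⟨a, b, hb, rfl⟩ := (mem_localizationSubring P.2).1 hPx
  exact ⟨PrimeSpectrum.basicOpen b, fun Q hQ => (mem_localizationSubring Q.2).2 ⟨a, b, hQ, rfl⟩,
    (PrimeSpectrum.basicOpen b).2, hb⟩

/-! ### Charts of a projective model -/

section Chart

variable {n : ℕ} {D : Subring F} {x : Fin n → F}

theorem le_modelChart (i : Fin n) : D ≤ modelChart D x i := fun _ hd =>
  Subring.subset_closure (Or.inl hd)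

theorem div_mem_modelChart (i j : Fin n) : x j * (x i)⁻¹ ∈ modelChart D x i :=
  Subring.subset_closure (Or.inr ⟨j, rfl⟩)

theorem modelChart_le {R : Subring F} {i : Fin n} (hD : D ≤ R)
    (h : ∀ j, x j * (x i)⁻¹ ∈ R) : modelChart D x i ≤ R := by
  refine Subring.closure_le.2 (Set.union_subset hD ?_)
  rintro _ ⟨j, rfl⟩
  exact h j

theorem isNoetherianRing_modelChart_quotient [IsLocalRing D] (i : Fin n)
    (J : Ideal (modelChart D x i))
    (hJ : (IsLocalRing.maximalIdeal D).map (Subring.inclusion (le_modelChart i)) ≤ J) :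
    IsNoetherianRing (modelChart D x i ⧸ J) := by
  let f : IsLocalRing.ResidueField D →+* modelChart D x i ⧸ J :=
    Ideal.Quotient.lift (IsLocalRing.maximalIdeal D)
      ((Ideal.Quotient.mk J).comp (Subring.inclusion (le_modelChart i)))
      fun d hd => Ideal.Quotient.eq_zero_iff_mem.2 (hJ (Ideal.mem_map_of_mem _ hd))
  let g : MvPolynomial (Fin n) (IsLocalRing.ResidueField D) →+* modelChart D x i ⧸ J :=
    MvPolynomial.eval₂Hom f fun j => Ideal.Quotient.mk J ⟨_, div_mem_modelChart i j⟩
  have hle : modelChart D x i ≤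
      (g.range.comap (Ideal.Quotient.mk J)).map (modelChart D x i).subtype := by
    refine modelChart_le (fun d hd => ?_) fun j => ?_
    · exact ⟨⟨d, le_modelChart i hd⟩, ⟨MvPolynomial.C (IsLocalRing.residue D ⟨d, hd⟩),
        MvPolynomial.eval₂_C _ _ _⟩, rfl⟩
    · exact ⟨⟨_, div_mem_modelChart i j⟩, ⟨MvPolynomial.X j, MvPolynomial.eval₂_X _ _ _⟩, rfl⟩
  refine isNoetherianRing_of_surjective _ _ g fun y => ?_
  obtain ⟨z, rfl⟩ := Ideal.Quotient.mk_surjective y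
  obtain ⟨w, hw, hwz⟩ := hle z.2
  obtain rfl : w = z := Subtype.ext hwz
  exact hw

theorem finite_minimalPrimes_of_isNoetherianRing_quotient {A : Type*} [CommRing A] (J : Ideal A)
    [IsNoetherianRing (A ⧸ J)] : J.minimalPrimes.Finite := by
  rw [Ideal.minimalPrimes_eq_comap]
  exact (minimalPrimes.finite_of_isNoetherianRing _).image _

/-- The members of a chart lying in a closed subset of the fibre over the closed point are
contained in finitely many such members. -/
theorem exists_finite_generic [IsLocalRing D] {X : Set (Subring F)} {C : Set X}
    (hC : @IsClosed _ (zariskiTop X) C) (i : Fin n)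
    (hX : ∀ P : Ideal (modelChart D x i), P.IsPrime →
      localizationSubring (modelChart D x i) P ∈ X) :
    ∃ S : Set (Subring F), S.Finite ∧
      S ⊆ Subtype.val '' (C ∩ {α : X | Dominates α.1 D}) ∧
      ∀ (P : Ideal (modelChart D x i)) (hP : P.IsPrime),
        (⟨_, hX P hP⟩ : X) ∈ C → Dominates (localizationSubring _ P) D →
        ∃ α ∈ S, localizationSubring _ P ≤ α := by
  have hcl : IsClosed ((fun P : PrimeSpectrum (modelChart D x i) =>
      (⟨localizationSubring _ P.asIdeal, hX P.asIdeal P.2⟩ : X)) ⁻¹' C) :=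
    @IsClosed.preimage _ _ _ (zariskiTop X) _
      (continuous_localizationSubring _ fun P => hX P.asIdeal P.2) _ hC
  obtain ⟨I, hI⟩ := (PrimeSpectrum.isClosed_iff_zeroLocus_ideal _).1 hcl
  have mem_C : ∀ (P : Ideal (modelChart D x i)) (hP : P.IsPrime),
      (⟨_, hX P hP⟩ : X) ∈ C ↔ I ≤ P := fun P hP => Set.ext_iff.1 hI ⟨P, hP⟩
  let M := (IsLocalRing.maximalIdeal D).map (Subring.inclusion (le_modelChart (x := x) i))
  have := isNoetherianRing_modelChart_quotient i (M ⊔ I) le_sup_left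
  refine ⟨localizationSubring _ '' (M ⊔ I).minimalPrimes,
    (finite_minimalPrimes_of_isNoetherianRing_quotient (M ⊔ I)).image _, ?_, ?_⟩
  · rintro _ ⟨P, hP, rfl⟩
    have hPp : P.IsPrime := hP.1.1
    exact ⟨⟨_, hX P hPp⟩, ⟨(mem_C P hPp).2 (le_sup_right.trans hP.1.2),
      (dominates_localizationSubring_iff (le_modelChart i) hPp).2
        (le_sup_left.trans hP.1.2)⟩, rfl⟩
  · intro P hP hPC hPD
    obtain ⟨Q, hQ, hQP⟩ := Ideal.exists_minimalPrimes_le (I := M ⊔ I) (J := P)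
      (sup_le ((dominates_localizationSubring_iff (le_modelChart i) hP).1 hPD)
        ((mem_C P hP).1 hPC))
    exact ⟨_, ⟨Q, hQ, rfl⟩, localizationSubring_anti hQ.1.1 hQP⟩

end Chart

/-! ### Valuation rings and their centers -/

/-- If `β ⊆ α` dominate `D` and `a` is a nonunit of `β` but a unit of `α`, then the residue of `a`
in `α` is transcendental over `D`. -/
theorem memMaxIdeal_coeff {D α β : Subring F} [IsLocalRing α] [IsLocalRing β]
    (hαD : Dominates α D) (hβD : Dominates β D) (hβα : β ≤ α) {a : F} (ha : MemMaxIdeal β a)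
    (ha0 : a ≠ 0) (hinv : a⁻¹ ∈ α) (m : ℕ) (p : Polynomial D)
    (hp : MemMaxIdeal α (p.eval₂ D.subtype a)) : MemMaxIdeal D (p.coeff m : F) := by
  have eval_mem : ∀ q : Polynomial D, q.eval₂ D.subtype a ∈ β := fun q => by
    rw [Polynomial.eval₂_eq_sum]
    exact sum_mem fun i _ => mul_mem (hβD.1 (q.coeff i).2) (pow_mem ha.1 i)
  have decomp : ∀ q : Polynomial D,
      q.eval₂ D.subtype a = a * q.divX.eval₂ D.subtype a + q.coeff 0 := fun q => by
    conv_lhs => rw [← Polynomial.divX_mul_X_add q, Polynomial.eval₂_add, Polynomial.eval₂_mul_X,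
      Polynomial.eval₂_C, mul_comm]
    rfl
  have coeff_zero : ∀ q : Polynomial D, MemMaxIdeal α (q.eval₂ D.subtype a) →
      MemMaxIdeal D (q.coeff 0 : F) := fun q hq => by
    have h1 := hq.mono hβα (eval_mem q)
    have h2 := h1.sub (ha.mul (eval_mem q.divX))
    rw [hβD.2 _ (q.coeff 0).2]
    convert h2 using 1
    rw [decomp q]
    ring
  induction m generalizing p with
  | zero => exact coeff_zero p hp
  | succ m ih =>
    rw [← Polynomial.coeff_divX]
    refine ih _ ?_
    have h1 := (hp.sub ((hαD.2 _ (p.coeff 0).2).1 (coeff_zero p hp))).mul hinv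
    convert h1 using 1
    rw [decomp p]
    field_simp
    ring

theorem exists_valuationSubring_inv_mem_nonunits {D α β : Subring F}
    [IsLocalRing α] [IsLocalRing β] (hαD : Dominates α D) (hβD : Dominates β D) (hβα : β ≤ α)
    {a : F} (ha : MemMaxIdeal β a) (ha0 : a ≠ 0) (hinv : a⁻¹ ∈ α) :
    ∃ V : ValuationSubring F, D ≤ V.toSubring ∧ (∀ x, MemMaxIdeal α x → x ∈ V.nonunits) ∧
      a⁻¹ ∈ V.nonunits := by
  let φ : α →+* IsLocalRing.ResidueField α := IsLocalRing.residue α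
  let ψ : D →+* α := Subring.inclusion hαD.1
  let : Algebra D (IsLocalRing.ResidueField α) := (φ.comp ψ).toAlgebra
  let a' : α := ⟨a, hβα ha.1⟩
  let b' : α := ⟨a⁻¹, hinv⟩
  have hba : φ b' * φ a' = 1 := by
    rw [← map_mul, ← map_one φ]
    exact congrArg φ (Subtype.ext (inv_mul_cancel₀ ha0))
  let inst : Invertible (φ b') := ⟨φ a', by rw [mul_comm, hba], hba⟩
  let B := Algebra.adjoin D {φ b'}
  let b : B := ⟨φ b', Algebra.subset_adjoin rfl⟩
  have hJ : Ideal.span {b} ≠ ⊤ := fun eq => by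
    obtain ⟨p, hp, hpx⟩ := Algebra.exists_aeval_invOf_eq_zero_of_idealMap_adjoin_sup_span_eq_top (φ b')
      (⊥ : Ideal D) bot_ne_top (top_unique <| eq.ge.trans le_add_self)
    have hp1 : p.leadingCoeff = 1 := by simpa [sub_eq_zero] using hp
    have e : φ (p.eval₂ ψ a') = 0 := by
      rw [Polynomial.hom_eval₂]
      exact hpx
    have e' : p.eval₂ D.subtype a = (p.eval₂ ψ a' : α) :=
      (Polynomial.hom_eval₂ p ψ α.subtype a').symm
    have hm : MemMaxIdeal α (p.eval₂ D.subtype a) := by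
      rw [e']
      exact (memMaxIdeal_coe _).2 (Ideal.Quotient.eq_zero_iff_mem.1 e)
    have := memMaxIdeal_coeff hαD hβD hβα ha ha0 hinv p.natDegree p hm
    rw [Polynomial.coeff_natDegree, hp1] at this
    exact not_memMaxIdeal_one D this
  let R : Subring F := (B.toSubring.comap φ).map α.subtype
  have hRα : R ≤ α := by
    rintro _ ⟨y, -, rfl⟩
    exact y.2
  have mem_R : ∀ y : α, φ y ∈ B → (y : F) ∈ R := fun y hy => ⟨y, hy, rfl⟩
  let f : R →+* B := (φ.comp (Subring.inclusion hRα)).codRestrict B (by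
    rintro ⟨_, y, hy, rfl⟩
    exact hy)
  obtain ⟨V, hRV, hV⟩ := Ideal.image_subset_nonunits_valuationSubring
    ((Ideal.span {b}).comap f) (Ideal.comap_ne_top f hJ)
  refine ⟨V, fun d hd => hRV (mem_R ⟨d, hαD.1 hd⟩ (B.algebraMap_mem ⟨d, hd⟩)), fun x hx => ?_, ?_⟩
  · have h0 : φ ⟨x, hx.1⟩ = 0 := Ideal.Quotient.eq_zero_iff_mem.2 hx.2
    have hxR : x ∈ R := mem_R ⟨x, hx.1⟩ (h0 ▸ B.zero_mem)
    refine hV ⟨⟨x, hxR⟩, ?_, rfl⟩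
    have : f ⟨x, hxR⟩ = 0 := Subtype.ext h0
    change f ⟨x, hxR⟩ ∈ Ideal.span {b}
    rw [this]
    exact Ideal.zero_mem _
  · exact hV ⟨⟨a⁻¹, mem_R b' b.2⟩, Ideal.subset_span rfl, rfl⟩

theorem exists_center {D : Subring F} [IsLocalRing D] {X : Set (Subring F)}
    (hX : IsProjModel D X) {α : Subring F} (hα : α ∈ X) (hαD : Dominates α D)
    (V : ValuationSubring F) (hDV : D ≤ V.toSubring)
    (hV : ∀ x, MemMaxIdeal α x → x ∈ V.nonunits) :
    ∃ β ∈ X, β ≤ α ∧ β ≤ V.toSubring ∧ Dominates β D := by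
  obtain ⟨n, x, hx0, rfl⟩ := hX
  obtain ⟨l, Q, hQ, rfl⟩ := hα
  set α := localizationSubring (modelChart D x l) Q
  obtain ⟨i, hi⟩ := Finite.exists_max fun j => V.valuation (x j)
  have hxV : ∀ j, x j * (x i)⁻¹ ∈ V.toSubring := fun j => by
    change x j * (x i)⁻¹ ∈ V
    rw [← V.valuation_le_one_iff, map_mul, map_inv₀]
    exact mul_inv_le_one_of_le₀ (hi j) zero_le
  have hAV : modelChart D x i ≤ V.toSubring := modelChart_le hDV hxV
  have unit_α : ∀ y ∈ α, y ∉ V.nonunits → y⁻¹ ∈ α := fun y hy hyV => by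
    by_contra h
    exact hyV (hV y (memMaxIdeal_iff.2 ⟨hy, fun hu => h hu.2⟩))
  have hlα : ∀ j, x j * (x l)⁻¹ ∈ α := fun j =>
    le_localizationSubring hQ (div_mem_modelChart l j)
  have hil : (x i * (x l)⁻¹)⁻¹ ∈ α := by
    refine unit_α _ (hlα i) fun h => ?_
    rw [V.mem_nonunits_iff_or] at h
    refine h.elim (mul_ne_zero (hx0 i) (inv_ne_zero (hx0 l))) fun h => h ?_
    rw [mul_inv, inv_inv, mul_comm]
    exact hxV l
  have hAα : modelChart D x i ≤ α := by
    refine modelChart_le hαD.1 fun j => ?_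
    have e : x j * (x i)⁻¹ = x j * (x l)⁻¹ * (x i * (x l)⁻¹)⁻¹ := by
      have := hx0 i
      have := hx0 l
      field_simp
    rw [e]
    exact mul_mem (hlα j) hil
  let P : Ideal (modelChart D x i) :=
    (IsLocalRing.maximalIdeal V).comap (Subring.inclusion hAV)
  have hP : P.IsPrime := Ideal.comap_isPrime (Subring.inclusion hAV) (IsLocalRing.maximalIdeal V)
  have mem_P : ∀ y : modelChart D x i, y ∈ P ↔ (y : F) ∈ V.nonunits := fun y =>
    (V.coe_mem_nonunits_iff (a := ⟨y, hAV y.2⟩)).symm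
  refine ⟨localizationSubring _ P, ⟨i, P, hP, rfl⟩, ?_, ?_, ?_⟩
  · exact localizationSubring_le hAα fun b hb =>
      unit_α b (hAα b.2) fun h => hb ((mem_P b).2 h)
  · refine localizationSubring_le hAV fun b hb => ?_
    by_contra h
    exact hb ((mem_P b).2 (V.mem_nonunits_iff_or.2 (Or.inr h)))
  · rw [dominates_localizationSubring_iff (le_modelChart i) hP, Ideal.map_le_iff_le_comap]
    intro d hd
    exact (mem_P _).2 (hV d ((hαD.2 d d.2).1 ((memMaxIdeal_coe d).2 hd)))

/-- Let `D` be a local subring of `F` with Noetherian prime spectrum, `X` a projective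
model of `F/D`, and `Y` a nonempty Zariski closed subset of the set of members of `X`
dominating `D`. Then `A(Y)` is semilocal and each of its maximal ideals is the
contraction of the maximal ideal of some member of `Y`. -/
theorem statement15 (D : Subring F) (hD : IsLocalRing D)
    (hNoeth : TopologicalSpace.NoetherianSpace (PrimeSpectrum D))
    (X : Set (Subring F)) (hX : IsProjModel D X)
    (Y : Set ↥X) (hne : Y.Nonempty)
    (hYdom : ∀ α ∈ Y, Dominates α.1 D)
    (hYclosed : ∃ C : Set ↥X, @IsClosed _ (zariskiTop X) C ∧
      Y = C ∩ {α : ↥X | Dominates α.1 D}) :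
    {I : Ideal ↥(sInf (Subtype.val '' Y)) | I.IsMaximal}.Finite ∧
    ∀ I : Ideal ↥(sInf (Subtype.val '' Y)), I.IsMaximal →
      ∃ α ∈ Y, ∀ x : ↥(sInf (Subtype.val '' Y)), x ∈ I ↔ MemMaxIdeal α.1 (x : F) := by
  obtain ⟨C, hC, rfl⟩ := hYclosed
  set Y := C ∩ {α : ↥X | Dominates α.1 D}
  set A := sInf (Subtype.val '' Y) with hA
  have mem_A : ∀ {a : F}, a ∈ A ↔ ∀ α ∈ Y, a ∈ (α : Subring F) := fun {a} => by
    simp [hA, Subring.mem_sInf]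
  have isLocal : ∀ α : X, IsLocalRing α.1 := by
    rintro ⟨α, hα⟩
    obtain ⟨n, x, -, rfl⟩ := hX
    obtain ⟨i, P, hP, rfl⟩ := hα
    exact isLocalRing_localizationSubring hP
  have unit_transfer : ∀ α ∈ Y, ∀ β ∈ Y, β.1 ≤ α.1 → ∀ a ∈ A, MemMaxIdeal β.1 a →
      MemMaxIdeal α.1 a := by
    intro α hα β hβ hβα a ha haβ
    by_contra hn
    rw [memMaxIdeal_iff, not_and_not_right] at hn
    obtain ⟨ha0, hinv⟩ := hn (hβα haβ.1)
    have := isLocal α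
    have := isLocal β
    obtain ⟨V, hDV, hαV, haV⟩ :=
      exists_valuationSubring_inv_mem_nonunits hα.2 hβ.2 hβα haβ ha0 hinv
    obtain ⟨γ, hγX, hγα, hγV, hγD⟩ := exists_center hX α.2 hα.2 V hDV hαV
    have hγ : (⟨γ, hγX⟩ : X) ∈ Y := ⟨mem_of_isClosed_of_le hC hα.1 hγα, hγD⟩
    exact (V.inv_mem_nonunits_iff.1 haV).elim ha0 fun h => h (hγV (mem_A.1 ha _ hγ))
  obtain ⟨S, hSfin, hSY, hS⟩ : ∃ S : Set (Subring F), S.Finite ∧ S ⊆ Subtype.val '' Y ∧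
      ∀ β ∈ Y, ∃ α ∈ S, β.1 ≤ α := by
    obtain ⟨n, x, -, rfl⟩ := hX
    choose S hSfin hSY hS using fun i =>
      exists_finite_generic (D := D) (x := x) hC i fun P hP => ⟨i, P, hP, rfl⟩
    refine ⟨⋃ i, S i, Set.finite_iUnion hSfin, Set.iUnion_subset hSY, ?_⟩
    rintro ⟨_, i, P, hP, rfl⟩ hβ
    obtain ⟨α, hα, hle⟩ := hS i P hP hβ.1 hβ.2
    exact ⟨α, Set.mem_iUnion.2 ⟨i, hα⟩, hle⟩
  have contraction : ∀ α ∈ S, ∃ P : Ideal A, P.IsPrime ∧ ∀ x : A, x ∈ P ↔ MemMaxIdeal α x := by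
    intro α hα
    obtain ⟨α, hαY, rfl⟩ := hSY hα
    have := isLocal α
    have hle : A ≤ α.1 := fun a ha => mem_A.1 ha α hαY
    exact ⟨(IsLocalRing.maximalIdeal α.1).comap (Subring.inclusion hle),
      Ideal.comap_isPrime _ _, fun x => (memMaxIdeal_coe (Subring.inclusion hle x)).symm⟩
  choose! P hPprime hP using contraction
  have key : ∀ I : Ideal A, I.IsMaximal → ∃ α ∈ S, P α = I := by
    intro I hI
    have hcover : (I : Set A) ⊆ ⋃ α ∈ (hSfin.toFinset : Set (Subring F)), P α := by
      intro a haI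
      by_contra hn
      simp only [Set.Finite.coe_toFinset, Set.mem_iUnion, SetLike.mem_coe, not_exists] at hn
      have hunit : ∀ β ∈ Y, (a : F) ≠ 0 ∧ (a : F)⁻¹ ∈ β.1 := fun β hβ => by
        obtain ⟨α, hαS, hle⟩ := hS β hβ
        obtain ⟨α, hαY, rfl⟩ := hSY hαS
        by_contra h
        exact hn α hαS ((hP α hαS a).2 (unit_transfer α hαY β hβ hle a a.2
          (memMaxIdeal_iff.2 ⟨mem_A.1 a.2 β hβ, h⟩)))
      obtain ⟨β, hβ⟩ := hne
      refine hI.ne_top (I.eq_top_of_isUnit_mem haI (IsUnit.of_mul_eq_one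
        ⟨(a : F)⁻¹, mem_A.2 fun β hβ => (hunit β hβ).2⟩ (Subtype.ext ?_)))
      exact mul_inv_cancel₀ (hunit β hβ).1
    obtain ⟨α, hα, hle⟩ := (Ideal.subset_union_prime ⊥ ⊥ fun α hα _ _ =>
      hPprime α (hSfin.mem_toFinset.1 hα)).1 hcover
    have hαS := hSfin.mem_toFinset.1 hα
    exact ⟨α, hαS, (hI.eq_of_le (hPprime α hαS).ne_top hle).symm⟩
  refine ⟨(hSfin.image P).subset fun I hI => key I hI, fun I hI => ?_⟩
  obtain ⟨α, hαS, rfl⟩ := key I hI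
  obtain ⟨β, hβ, rfl⟩ := hSY hαS
  exact ⟨β, hβ, hP β.1 hαS⟩
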